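/- Let φ ∈ X, let φ̃(r) := ∫₀^r |φ'(s)| ds, define φ^±(r) := ½(φ̃(r) ± φ(r)) for r ≥ 0 and φ^±(r) := ±½ φ(0) for r < 0. Let η be a smooth mollifier supported in (0,1), η_ε(s) := ε⁻¹η(s/ε), and for ε > 0 set ψ_ε(r) := ∫₀^ε η_ε(s) φ⁺(r+s) ds − ∫₀^ε η_ε(s) φ⁻(r−s) ds. Then ψ_ε(r) ≥ φ(r) for all r ≥ 0, ψ_ε is a C¹ function belonging to X, ‖ψ_ε'‖_∞ ≤ (2/ε)‖η‖_∞‖φ‖_X, and ∫₀^∞ |ψ_ε(r) − φ(r)| dr ≤ c ε ‖φ‖_X for a constant c independent of φ, ε and η. -/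

import Mathlib

open MeasureTheory Metric Set intervalIntegral

noncomputable section

/-- The class `X`: continuous functions on `[0,∞)` whose derivative is continuous
up to a finite number of jumps. -/
def MemX (φ : ℝ → ℝ) : Prop :=
  ContinuousOn φ (Set.Ici 0) ∧
  ∃ J : Finset ℝ, (∀ x ∈ Set.Ici (0:ℝ) \ (J : Set ℝ), DifferentiableAt ℝ φ x) ∧
    ContinuousOn (deriv φ) (Set.Ici 0 \ (J : Set ℝ))

/-- The norm `‖φ‖_X = ∫₀^∞ |φ'(r)| dr`. -/
def normX (φ : ℝ → ℝ) : ℝ := ∫ r in Set.Ioi (0:ℝ), |deriv φ r|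

/-- `φ̃(r) = ∫₀^r |φ'(s)| ds`. -/
def phiTilde (φ : ℝ → ℝ) (r : ℝ) : ℝ := ∫ s in (0:ℝ)..r, |deriv φ s|

/-- `φ⁺(r) = ½(φ̃(r) + φ(r))` for `r ≥ 0`, `φ⁺(r) = ½φ(0)` for `r < 0`. -/
def phiPlus (φ : ℝ → ℝ) (r : ℝ) : ℝ :=
  if 0 ≤ r then (phiTilde φ r + φ r) / 2 else φ 0 / 2

/-- `φ⁻(r) = ½(φ̃(r) − φ(r))` for `r ≥ 0`, `φ⁻(r) = −½φ(0)` for `r < 0`. -/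
def phiMinus (φ : ℝ → ℝ) (r : ℝ) : ℝ :=
  if 0 ≤ r then (phiTilde φ r - φ r) / 2 else -(φ 0) / 2

/-- A mollifier: a smooth nonnegative function with compact support in `(0,1)`
and total integral `1`. -/
def IsMollifier (η : ℝ → ℝ) : Prop :=
  ContDiff ℝ (⊤ : ℕ∞) η ∧ (∀ s, 0 ≤ η s) ∧ tsupport η ⊆ Set.Ioo 0 1 ∧ (∫ s, η s) = 1

/-- `ψ_ε(r) = ∫₀^ε η_ε(s) φ⁺(r+s) ds − ∫₀^ε η_ε(s) φ⁻(r−s) ds`, with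
`η_ε(s) = ε⁻¹ η(s/ε)`. -/
def psiEps (φ η : ℝ → ℝ) (ε : ℝ) (r : ℝ) : ℝ :=
  (∫ s in (0:ℝ)..ε, ε⁻¹ * η (s / ε) * phiPlus φ (r + s)) -
    ∫ s in (0:ℝ)..ε, ε⁻¹ * η (s / ε) * phiMinus φ (r - s)

/-- A bounded increment of a continuous function, averaged over a shift, is controlled by the
length of the shift. -/
lemma integral_shift_sub_le {F : ℝ → ℝ} {V : ℝ} (hF : Continuous F)
    (hV : ∀ a b, a ≤ b → F b - F a ≤ V) {a b h : ℝ} (hab : a ≤ b) (hh : 0 ≤ h) :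
    ∫ x in a..b, (F (x + h) - F x) ≤ h * V := by
  have hi : ∀ c d, IntervalIntegrable F volume c d := fun c d => hF.intervalIntegrable c d
  have hshift : ∀ c : ℝ, IntervalIntegrable (fun x => F (x + c)) volume 0 h := fun c =>
    (by fun_prop : Continuous fun x => F (x + c)).intervalIntegrable _ _
  have h1 : ∫ x in a..b, (F (x + h) - F x) = ∫ x in (0:ℝ)..h, (F (x + b) - F (x + a)) := by
    rw [integral_sub
      ((by fun_prop : Continuous fun x => F (x + h)).intervalIntegrable _ _) (hi _ _),
      integral_sub (hshift b) (hshift a), integral_comp_add_right, integral_comp_add_right,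
      integral_comp_add_right, zero_add, zero_add, add_comm h b, add_comm h a]
    have e1 := integral_add_adjacent_intervals (hi a b) (hi b (b + h))
    have e2 := integral_add_adjacent_intervals (hi a (a + h)) (hi (a + h) (b + h))
    linarith
  rw [h1]
  calc ∫ x in (0:ℝ)..h, (F (x + b) - F (x + a)) ≤ ∫ _ in (0:ℝ)..h, V :=
        integral_mono_on hh ((hshift b).sub (hshift a)) intervalIntegrable_const
          fun x _ => hV _ _ (by linarith)
    _ = h * V := by simp

/-- Averaging a continuous monotone function against a nonnegative kernel bounded by `C` gives a
function that increases at rate at most `C` times the total increment. -/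
lemma average_increment_mem {k F : ℝ → ℝ} {C V ε : ℝ} (hε : 0 ≤ ε) (hk : Continuous k)
    (hk0 : ∀ s, 0 ≤ k s) (hkC : ∀ s, k s ≤ C) (hF : Continuous F) (hm : Monotone F)
    (hV : ∀ a b, a ≤ b → F b - F a ≤ V) {x y : ℝ} (hxy : x ≤ y) :
    (∫ s in (0:ℝ)..ε, k s * F (y + s)) - ∫ s in (0:ℝ)..ε, k s * F (x + s) ∈
      Icc 0 (C * V * (y - x)) := by
  have hi : ∀ z, IntervalIntegrable (fun s => k s * F (z + s)) volume 0 ε := fun z =>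
    (by fun_prop : Continuous fun s => k s * F (z + s)).intervalIntegrable _ _
  have hC : 0 ≤ C := (hk0 0).trans (hkC 0)
  rw [← integral_sub (hi y) (hi x)]
  constructor
  · refine integral_nonneg hε fun s _ => ?_
    rw [← mul_sub]
    exact mul_nonneg (hk0 s) (sub_nonneg.2 (hm (by linarith)))
  · calc ∫ s in (0:ℝ)..ε, (k s * F (y + s) - k s * F (x + s))
        ≤ ∫ s in (0:ℝ)..ε, C * (F (y + s) - F (x + s)) := by
          refine integral_mono_on hε ((hi y).sub (hi x))
            ((by fun_prop : Continuous fun s => C * (F (y + s) - F (x + s))).intervalIntegrable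
              _ _) fun s _ => ?_
          rw [← mul_sub]
          exact mul_le_mul_of_nonneg_right (hkC s) (sub_nonneg.2 (hm (by linarith)))
      _ = C * ∫ s in (0:ℝ)..ε, (F ((s + x) + (y - x)) - F (s + x)) := by
          rw [intervalIntegral.integral_const_mul]
          congr 1
          refine integral_congr fun s _ => ?_
          ring_nf
      _ = C * ∫ s in (0 + x)..(ε + x), (F (s + (y - x)) - F s) := by
          rw [integral_comp_add_right (fun s => F (s + (y - x)) - F s)]
      _ ≤ C * ((y - x) * V) := mul_le_mul_of_nonneg_left
          (integral_shift_sub_le hF hV (by linarith) (by linarith)) hC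
      _ = C * V * (y - x) := by ring

lemma monotone_neg_comp_neg {F : ℝ → ℝ} (hm : Monotone F) : Monotone fun x => -F (-x) :=
  fun _ _ h => neg_le_neg (hm (neg_le_neg h))

/-- The backward version of `average_increment_mem`. -/
lemma average_increment_mem_sub {k F : ℝ → ℝ} {C V ε : ℝ} (hε : 0 ≤ ε) (hk : Continuous k)
    (hk0 : ∀ s, 0 ≤ k s) (hkC : ∀ s, k s ≤ C) (hF : Continuous F) (hm : Monotone F)
    (hV : ∀ a b, a ≤ b → F b - F a ≤ V) {x y : ℝ} (hxy : x ≤ y) :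
    (∫ s in (0:ℝ)..ε, k s * F (y - s)) - ∫ s in (0:ℝ)..ε, k s * F (x - s) ∈
      Icc 0 (C * V * (y - x)) := by
  have h := average_increment_mem (F := fun x => -F (-x)) (V := V) (x := -y) (y := -x) hε hk hk0 hkC
    (by fun_prop) (monotone_neg_comp_neg hm)
    (fun a b hab => by linarith [hV (-b) (-a) (by linarith)]) (by linarith)
  have e : ∀ z, ∫ s in (0:ℝ)..ε, k s * -F (-(-z + s)) = -∫ s in (0:ℝ)..ε, k s * F (z - s) := by
    intro z
    rw [← intervalIntegral.integral_neg]
    refine integral_congr fun s _ => ?_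
    rw [neg_add, neg_neg, mul_neg, sub_eq_add_neg]
  rwa [e, e, neg_sub_neg, neg_sub_neg] at h

/-- Averaging a continuous function against a smooth kernel supported in `(0, ε]` is `C¹`. -/
lemma contDiff_average_sub {k F : ℝ → ℝ} {ε : ℝ} (hε : 0 ≤ ε) (hk : ContDiff ℝ 1 k)
    (hsupp : Function.support k ⊆ Ioc 0 ε) (hF : Continuous F) :
    ContDiff ℝ 1 fun r => ∫ s in (0:ℝ)..ε, k s * F (r - s) := by
  have hc : HasCompactSupport k :=
    HasCompactSupport.of_support_subset_isCompact isCompact_Icc (hsupp.trans Ioc_subset_Icc_self)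
  have h := hc.contDiff_convolution_left (ContinuousLinearMap.mul ℝ ℝ) (μ := volume) (n := (1 : ℕ∞)) (by exact_mod_cast hk)
    hF.locallyIntegrable
  have e : (fun r => ∫ s in (0:ℝ)..ε, k s * F (r - s)) =
      convolution k F (ContinuousLinearMap.mul ℝ ℝ) volume := by
    ext r
    rw [convolution_def, integral_of_le hε, setIntegral_eq_integral_of_forall_compl_eq_zero]
    · rfl
    · intro s hs
      rw [Function.notMem_support.1 fun h => hs (hsupp h), zero_mul]
  rw [e]
  exact_mod_cast h

/-- The forward version of `contDiff_average_sub`. -/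
lemma contDiff_average_add {k F : ℝ → ℝ} {ε : ℝ} (hε : 0 ≤ ε) (hk : ContDiff ℝ 1 k)
    (hsupp : Function.support k ⊆ Ioc 0 ε) (hF : Continuous F) :
    ContDiff ℝ 1 fun r => ∫ s in (0:ℝ)..ε, k s * F (r + s) := by
  have h := (contDiff_average_sub hε hk hsupp (F := fun x => F (-x)) (by fun_prop)).comp
    (contDiff_neg (n := 1) (𝕜 := ℝ) (F := ℝ))
  convert h using 2 with r
  refine integral_congr fun s _ => ?_
  dsimp only
  congr 2
  ring

/-- A weighted average lies between the bounds of the averaged function. -/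
lemma average_mem_Icc {k f : ℝ → ℝ} {ε m M : ℝ} (hε : 0 ≤ ε) (hk : Continuous k)
    (hk0 : ∀ s, 0 ≤ k s) (hk1 : ∫ s in (0:ℝ)..ε, k s = 1) (hf : Continuous f)
    (h : ∀ s ∈ Icc 0 ε, f s ∈ Icc m M) :
    ∫ s in (0:ℝ)..ε, k s * f s ∈ Icc m M := by
  have hi : IntervalIntegrable (fun s => k s * f s) volume 0 ε :=
    (by fun_prop : Continuous fun s => k s * f s).intervalIntegrable _ _
  have hc : ∀ c : ℝ, IntervalIntegrable (fun s => k s * c) volume 0 ε := fun c =>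
    (by fun_prop : Continuous fun s => k s * c).intervalIntegrable _ _
  have he : ∀ c : ℝ, ∫ s in (0:ℝ)..ε, k s * c = c := fun c => by
    rw [intervalIntegral.integral_mul_const, hk1, one_mul]
  constructor
  · rw [← he m]
    exact integral_mono_on hε (hc m) hi fun s hs => mul_le_mul_of_nonneg_left (h s hs).1 (hk0 s)
  · rw [← he M]
    exact integral_mono_on hε hi (hc M) fun s hs => mul_le_mul_of_nonneg_left (h s hs).2 (hk0 s)

section ClassX

variable {φ : ℝ → ℝ}

lemma integrableOn_deriv (hI : IntegrableOn (fun r => |deriv φ r|) (Ioi 0)) :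
    IntegrableOn (deriv φ) (Ioi 0) :=
  (integrable_norm_iff (measurable_deriv φ).aestronglyMeasurable).1 hI

lemma intervalIntegrable_of_integrableOn_Ioi {f : ℝ → ℝ} (hf : IntegrableOn f (Ioi 0)) {a b : ℝ}
    (ha : 0 ≤ a) (hab : a ≤ b) : IntervalIntegrable f volume a b :=
  (intervalIntegrable_iff_integrableOn_Ioc_of_le hab).2
    (hf.mono_set fun _ hx => ha.trans_lt hx.1)

lemma phiTilde_sub (hI : IntegrableOn (fun r => |deriv φ r|) (Ioi 0)) {a b : ℝ}
    (ha : 0 ≤ a) (hab : a ≤ b) :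
    phiTilde φ b - phiTilde φ a = ∫ s in a..b, |deriv φ s| :=
  integral_interval_sub_left (intervalIntegrable_of_integrableOn_Ioi hI le_rfl (ha.trans hab))
    (intervalIntegrable_of_integrableOn_Ioi hI le_rfl ha)

lemma phiTilde_sub_le_normX (hI : IntegrableOn (fun r => |deriv φ r|) (Ioi 0)) {a b : ℝ}
    (ha : 0 ≤ a) (hab : a ≤ b) : phiTilde φ b - phiTilde φ a ≤ normX φ := by
  rw [phiTilde_sub hI ha hab, integral_of_le hab]
  exact setIntegral_mono_set hI (ae_of_all _ fun _ => abs_nonneg _)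
    (LE.le.eventuallyLE fun _ hx => ha.trans_lt hx.1)

lemma abs_sub_le_phiTilde_sub (hφ : MemX φ) (hI : IntegrableOn (fun r => |deriv φ r|) (Ioi 0))
    {a b : ℝ} (ha : 0 ≤ a) (hab : a ≤ b) : |φ b - φ a| ≤ phiTilde φ b - phiTilde φ a := by
  obtain ⟨hc, J, hd, -⟩ := hφ
  rw [phiTilde_sub hI ha hab, ← integral_eq_of_hasDerivAt_off_countable_of_le φ (deriv φ) hab
    J.countable_toSet (hc.mono fun x hx => ha.trans hx.1)
    (fun x hx => (hd x ⟨ha.trans hx.1.1.le, hx.2⟩).hasDerivAt)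
    (intervalIntegrable_of_integrableOn_Ioi (integrableOn_deriv hI) ha hab)]
  exact abs_integral_le_integral_abs hab

lemma continuous_phiTilde_max (hI : IntegrableOn (fun r => |deriv φ r|) (Ioi 0)) :
    Continuous fun r => phiTilde φ (max r 0) := by
  have h : Integrable ((Ioi (0:ℝ)).indicator fun r => |deriv φ r|) :=
    hI.integrable_indicator measurableSet_Ioi
  have hcont := (continuous_primitive (fun a b => h.intervalIntegrable (a := a) (b := b)) 0).comp
    (continuous_id.max (continuous_const (y := (0:ℝ))))
  convert hcont using 2 with r
  refine integral_congr_ae (ae_of_all _ fun s hs => ?_)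
  rw [uIoc_of_le (le_max_right _ _)] at hs
  exact (indicator_of_mem (mem_Ioi.2 hs.1) fun r => |deriv φ r|).symm

lemma continuous_comp_max (hφ : MemX φ) : Continuous fun r => φ (max r 0) :=
  hφ.1.comp_continuous (by fun_prop) fun r => mem_Ici.2 (le_max_right r 0)

lemma phiPlus_eq (φ : ℝ → ℝ) :
    phiPlus φ = fun r => (phiTilde φ (max r 0) + φ (max r 0)) / 2 := by
  ext r
  unfold phiPlus
  split_ifs with h
  · rw [max_eq_left h]
  · rw [max_eq_right (not_le.1 h).le, phiTilde, integral_same, zero_add]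

lemma phiMinus_eq (φ : ℝ → ℝ) :
    phiMinus φ = fun r => (phiTilde φ (max r 0) - φ (max r 0)) / 2 := by
  ext r
  unfold phiMinus
  split_ifs with h
  · rw [max_eq_left h]
  · rw [max_eq_right (not_le.1 h).le, phiTilde, integral_same, zero_sub]

lemma continuous_phiPlus (hφ : MemX φ) (hI : IntegrableOn (fun r => |deriv φ r|) (Ioi 0)) :
    Continuous (phiPlus φ) := by
  rw [phiPlus_eq]
  exact ((continuous_phiTilde_max hI).add (continuous_comp_max hφ)).div_const 2

lemma continuous_phiMinus (hφ : MemX φ) (hI : IntegrableOn (fun r => |deriv φ r|) (Ioi 0)) :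
    Continuous (phiMinus φ) := by
  rw [phiMinus_eq]
  exact ((continuous_phiTilde_max hI).sub (continuous_comp_max hφ)).div_const 2

lemma phiPlus_sub_mem (hφ : MemX φ) (hI : IntegrableOn (fun r => |deriv φ r|) (Ioi 0))
    {a b : ℝ} (hab : a ≤ b) : phiPlus φ b - phiPlus φ a ∈ Icc 0 (normX φ) := by
  have hm : max a 0 ≤ max b 0 := max_le_max_right 0 hab
  have h1 := abs_le.1 (abs_sub_le_phiTilde_sub hφ hI (le_max_right a 0) hm)
  have h2 := phiTilde_sub_le_normX hI (le_max_right a 0) hm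
  rw [phiPlus_eq]
  constructor <;> dsimp only <;> linarith [h1.1, h1.2]

lemma phiMinus_sub_mem (hφ : MemX φ) (hI : IntegrableOn (fun r => |deriv φ r|) (Ioi 0))
    {a b : ℝ} (hab : a ≤ b) : phiMinus φ b - phiMinus φ a ∈ Icc 0 (normX φ) := by
  have hm : max a 0 ≤ max b 0 := max_le_max_right 0 hab
  have h1 := abs_le.1 (abs_sub_le_phiTilde_sub hφ hI (le_max_right a 0) hm)
  have h2 := phiTilde_sub_le_normX hI (le_max_right a 0) hm
  rw [phiMinus_eq]
  constructor <;> dsimp only <;> linarith [h1.1, h1.2]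

lemma phiPlus_sub_phiMinus {r : ℝ} (hr : 0 ≤ r) : phiPlus φ r - phiMinus φ r = φ r := by
  rw [phiPlus, phiMinus, if_pos hr, if_pos hr]
  ring

end ClassX

section Mollifier

variable {η : ℝ → ℝ} {ε : ℝ}

lemma IsMollifier.support_rescale_subset (hη : IsMollifier η) (hε : 0 < ε) :
    Function.support (fun s => ε⁻¹ * η (s / ε)) ⊆ Ioc 0 ε := by
  intro s hs
  have h := hη.2.2.1 (subset_tsupport η (right_ne_zero_of_mul hs))
  exact ⟨(div_pos_iff_of_pos_right hε).1 h.1, ((div_lt_one hε).1 h.2).le⟩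

lemma IsMollifier.contDiff_rescale (hη : IsMollifier η) :
    ContDiff ℝ 1 fun s => ε⁻¹ * η (s / ε) := by
  have h : ContDiff ℝ 1 η := hη.1.of_le (by exact_mod_cast le_top)
  exact contDiff_const.mul (h.comp (contDiff_id.div_const ε))

lemma IsMollifier.integral_rescale (hη : IsMollifier η) (hε : 0 < ε) :
    ∫ s in (0:ℝ)..ε, ε⁻¹ * η (s / ε) = 1 := by
  rw [integral_of_le hε.le, setIntegral_eq_integral_of_forall_compl_eq_zero fun s hs =>
    Function.notMem_support.1 fun h => hs (hη.support_rescale_subset hε h),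
    MeasureTheory.integral_const_mul, Measure.integral_comp_div, hη.2.2.2, abs_of_pos hε, smul_eq_mul, mul_one,
    inv_mul_cancel₀ hε.ne']

lemma IsMollifier.le_iSup (hη : IsMollifier η) (s : ℝ) : η s ≤ ⨆ t, |η t| := by
  have hc : HasCompactSupport η := isCompact_Icc.of_isClosed_subset (isClosed_tsupport η)
    (hη.2.2.1.trans Ioo_subset_Icc_self)
  obtain ⟨C, hC⟩ := hc.exists_bound_of_continuous hη.1.continuous
  have hb : BddAbove (range fun t => |η t|) := ⟨C, forall_mem_range.2 hC⟩
  exact (le_abs_self _).trans (le_ciSup hb s)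

end Mollifier

lemma memX_of_contDiff {f : ℝ → ℝ} (hf : ContDiff ℝ 1 f) : MemX f :=
  ⟨hf.continuous.continuousOn, ∅, fun x _ => hf.differentiable one_ne_zero x,
    (hf.continuous_deriv le_rfl).continuousOn⟩

lemma psiEps_sub_mem {φ η : ℝ → ℝ} {ε : ℝ} (hφ : MemX φ)
    (hI : IntegrableOn (fun r => |deriv φ r|) (Ioi 0)) (hε : 0 < ε) (hη : IsMollifier η)
    {r : ℝ} (hr : 0 ≤ r) :
    psiEps φ η ε r - φ r ∈ Icc 0
      ((phiPlus φ (r + ε) - phiPlus φ r) + (phiMinus φ r - phiMinus φ (r - ε))) := by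
  have hk := (hη.contDiff_rescale (ε := ε)).continuous
  have hk0 : ∀ s, 0 ≤ ε⁻¹ * η (s / ε) := fun s => mul_nonneg (inv_nonneg.2 hε.le) (hη.2.1 _)
  have hp := continuous_phiPlus hφ hI
  have hm := continuous_phiMinus hφ hI
  have h1 := average_mem_Icc (f := fun s => phiPlus φ (r + s)) (m := phiPlus φ r)
    (M := phiPlus φ (r + ε)) hε.le hk hk0 (hη.integral_rescale hε) (by fun_prop) fun s hs =>
      ⟨sub_nonneg.1 (phiPlus_sub_mem hφ hI (by linarith [hs.1])).1,
        sub_nonneg.1 (phiPlus_sub_mem hφ hI (by linarith [hs.2])).1⟩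
  have h2 := average_mem_Icc (f := fun s => phiMinus φ (r - s)) (m := phiMinus φ (r - ε))
    (M := phiMinus φ r) hε.le hk hk0 (hη.integral_rescale hε) (by fun_prop) fun s hs =>
      ⟨sub_nonneg.1 (phiMinus_sub_mem hφ hI (by linarith [hs.2])).1,
        sub_nonneg.1 (phiMinus_sub_mem hφ hI (by linarith [hs.1])).1⟩
  rw [← phiPlus_sub_phiMinus (φ := φ) hr, psiEps]
  exact ⟨by linarith [h1.1, h2.2], by linarith [h1.2, h2.1]⟩

lemma contDiff_psiEps {φ η : ℝ → ℝ} {ε : ℝ} (hφ : MemX φ)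
    (hI : IntegrableOn (fun r => |deriv φ r|) (Ioi 0)) (hε : 0 < ε) (hη : IsMollifier η) :
    ContDiff ℝ 1 (psiEps φ η ε) :=
  (contDiff_average_add hε.le hη.contDiff_rescale (hη.support_rescale_subset hε)
    (continuous_phiPlus hφ hI)).sub
  (contDiff_average_sub hε.le hη.contDiff_rescale (hη.support_rescale_subset hε)
    (continuous_phiMinus hφ hI))

lemma normX_nonneg (φ : ℝ → ℝ) : 0 ≤ normX φ := integral_nonneg fun _ => abs_nonneg _

lemma abs_deriv_psiEps_le {φ η : ℝ → ℝ} {ε : ℝ} (hφ : MemX φ)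
    (hI : IntegrableOn (fun r => |deriv φ r|) (Ioi 0)) (hε : 0 < ε) (hη : IsMollifier η) (r : ℝ) :
    |deriv (psiEps φ η ε) r| ≤ (2 / ε) * (⨆ s : ℝ, |η s|) * normX φ := by
  set M := ⨆ s : ℝ, |η s|
  have hk := (hη.contDiff_rescale (ε := ε)).continuous
  have hk0 : ∀ s, 0 ≤ ε⁻¹ * η (s / ε) := fun s => mul_nonneg (inv_nonneg.2 hε.le) (hη.2.1 _)
  have hkC : ∀ s, ε⁻¹ * η (s / ε) ≤ ε⁻¹ * M := fun s =>
    mul_le_mul_of_nonneg_left (hη.le_iSup _) (inv_nonneg.2 hε.le)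
  have hM : 0 ≤ M := (hη.2.1 0).trans (hη.le_iSup 0)
  have hN := normX_nonneg φ
  have hD : 0 ≤ (2 / ε) * M * normX φ := by positivity
  have key : ∀ x y, x ≤ y →
      |psiEps φ η ε y - psiEps φ η ε x| ≤ (2 / ε) * M * normX φ * (y - x) := by
    intro x y hxy
    have h1 := average_increment_mem hε.le hk hk0 hkC (continuous_phiPlus hφ hI)
      (fun a b hab => sub_nonneg.1 (phiPlus_sub_mem hφ hI hab).1)
      (fun a b hab => (phiPlus_sub_mem hφ hI hab).2) hxy
    have h2 := average_increment_mem_sub hε.le hk hk0 hkC (continuous_phiMinus hφ hI)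
      (fun a b hab => sub_nonneg.1 (phiMinus_sub_mem hφ hI hab).1)
      (fun a b hab => (phiMinus_sub_mem hφ hI hab).2) hxy
    have e : (2 / ε) * M * normX φ * (y - x) = 2 * (ε⁻¹ * M * normX φ * (y - x)) := by
      ring
    rw [e, abs_le, psiEps, psiEps]
    exact ⟨by linarith [h1.1, h2.2, h1.2, h2.1], by linarith [h1.1, h2.2, h1.2, h2.1]⟩
  have hl : LipschitzWith (Real.toNNReal ((2 / ε) * M * normX φ)) (psiEps φ η ε) := by
    refine LipschitzWith.of_dist_le_mul fun x y => ?_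
    rw [Real.coe_toNNReal _ hD, Real.dist_eq, Real.dist_eq]
    rcases le_total x y with h | h
    · rw [abs_sub_comm, abs_sub_comm x y, abs_of_nonneg (sub_nonneg.2 h)]
      exact key x y h
    · rw [abs_of_nonneg (sub_nonneg.2 h)]
      exact key y x h
  have h := norm_deriv_le_of_lipschitz (x₀ := r) hl
  rwa [Real.coe_toNNReal _ hD] at h

lemma integral_abs_psiEps_sub_le {φ η : ℝ → ℝ} {ε : ℝ} (hφ : MemX φ)
    (hI : IntegrableOn (fun r => |deriv φ r|) (Ioi 0)) (hε : 0 < ε) (hη : IsMollifier η) :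
    ∫ r in Ioi (0:ℝ), |psiEps φ η ε r - φ r| ≤ 2 * ε * normX φ := by
  have hψ := (contDiff_psiEps hφ hI hε hη).continuous
  have hp := continuous_phiPlus hφ hI
  have hm := continuous_phiMinus hφ hI
  have hcont : ContinuousOn (fun r => psiEps φ η ε r - φ r) (Ici 0) :=
    hψ.continuousOn.sub hφ.1
  have hint : ∀ R : ℝ, 0 ≤ R →
      IntervalIntegrable (fun r => psiEps φ η ε r - φ r) volume 0 R := fun R hR =>
    (hcont.mono (by rw [uIcc_of_le hR]; exact Icc_subset_Ici_self)).intervalIntegrable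
  have hbound : ∀ R : ℝ, 0 ≤ R →
      ∫ r in (0:ℝ)..R, |psiEps φ η ε r - φ r| ≤ 2 * ε * normX φ := by
    intro R hR
    have hi1 : IntervalIntegrable (fun r => phiPlus φ (r + ε) - phiPlus φ r) volume 0 R :=
      (by fun_prop : Continuous fun r => phiPlus φ (r + ε) - phiPlus φ r).intervalIntegrable _ _
    have hi2 : IntervalIntegrable (fun r => phiMinus φ r - phiMinus φ (r - ε)) volume 0 R :=
      (by fun_prop : Continuous fun r =>
        phiMinus φ r - phiMinus φ (r - ε)).intervalIntegrable _ _
    have h1 := integral_shift_sub_le hp (fun a b hab => (phiPlus_sub_mem hφ hI hab).2) hR hε.le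
    have h2 := integral_shift_sub_le (F := fun x => phiMinus φ (x - ε)) (by fun_prop)
      (fun a b hab => (phiMinus_sub_mem hφ hI (sub_le_sub_right hab ε)).2) hR hε.le
    simp only [add_sub_cancel_right] at h2
    calc ∫ r in (0:ℝ)..R, |psiEps φ η ε r - φ r|
        ≤ ∫ r in (0:ℝ)..R, ((phiPlus φ (r + ε) - phiPlus φ r) +
            (phiMinus φ r - phiMinus φ (r - ε))) := by
          refine integral_mono_on hR (hint R hR).abs (hi1.add hi2) fun r hr => ?_
          have h := psiEps_sub_mem hφ hI hε hη hr.1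
          rw [abs_of_nonneg h.1]
          exact h.2
      _ ≤ 2 * ε * normX φ := by
          rw [integral_add hi1 hi2]
          linarith
  have hbound' : ∀ᶠ R : ℝ in Filter.atTop,
      ∫ r in (0:ℝ)..R, ‖psiEps φ η ε r - φ r‖ ≤ 2 * ε * normX φ :=
    (Filter.eventually_ge_atTop 0).mono hbound
  have hloc : ∀ R : ℝ, IntegrableOn (fun r => psiEps φ η ε r - φ r) (Ioc 0 R) := fun R =>
    ((hcont.mono Icc_subset_Ici_self).integrableOn_Icc).mono_set Ioc_subset_Icc_self
  have hfull := integrableOn_Ioi_of_intervalIntegral_norm_bounded _ 0 hloc Filter.tendsto_id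
    hbound'
  exact le_of_tendsto (intervalIntegral_tendsto_integral_Ioi 0 hfull.abs Filter.tendsto_id)
    hbound'

/-- For `φ ∈ X`, `ε > 0` and a mollifier `η`:
`ψ_ε ≥ φ` on `[0,∞)`, `ψ_ε` is a `C¹` function belonging to `X`,
`‖ψ_ε'‖_∞ ≤ (2/ε)‖η‖_∞‖φ‖_X`, and `∫₀^∞ |ψ_ε − φ| ≤ cε‖φ‖_X` for a constant `c`
independent of `φ`, `ε` and `η`. -/
theorem psiEps_properties :
    ∃ c : ℝ, 0 < c ∧
      ∀ (φ : ℝ → ℝ), MemX φ → IntegrableOn (fun r => |deriv φ r|) (Set.Ioi 0) →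
      ∀ (ε : ℝ), 0 < ε → ∀ (η : ℝ → ℝ), IsMollifier η →
        (∀ r : ℝ, 0 ≤ r → φ r ≤ psiEps φ η ε r) ∧
        ContDiff ℝ 1 (psiEps φ η ε) ∧ MemX (psiEps φ η ε) ∧
        (∀ r : ℝ, |deriv (psiEps φ η ε) r| ≤ (2 / ε) * (⨆ s : ℝ, |η s|) * normX φ) ∧
        (∫ r in Set.Ioi (0:ℝ), |psiEps φ η ε r - φ r|) ≤ c * ε * normX φ := by
  refine ⟨2, two_pos, fun φ hφ hI ε hε η hη => ⟨fun r hr => ?_, contDiff_psiEps hφ hI hε hη,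
    memX_of_contDiff (contDiff_psiEps hφ hI hε hη), abs_deriv_psiEps_le hφ hI hε hη,
    integral_abs_psiEps_sub_le hφ hI hε hη⟩⟩
  exact sub_nonneg.1 (psiEps_sub_mem hφ hI hε hη hr).1
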